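/- Let f : A → B and g : B → C be arbitrary maps between additive commutative groups, let J₁ be a finite nonempty index set, and let x : J₁ → A be a family. Then (∂^{|J₁|−1}(g∘f))((x_j)_{j∈J₁}) = ∑_{J₂} (∂^{|J₂|−1} g)( ((∂^{|T|−1} f)((x_j)_{j∈T}))_{T∈J₂} ), where J₂ ranges over all nonempty finite collections of nonempty subsets of J₁ whose union is J₁, and all iterated discrete derivatives are evaluated at the indicated families in any order (legitimate since iterated discrete derivatives are symmetric). (Discrete Chain Rule.) -/

import Mathlib

/-! Discrete Chain Rule. -/

/-- The iterated discrete derivative of an arbitrary map `f : A → B` between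
additive commutative groups. -/
def discDeriv {A B : Type*} [AddCommGroup A] [AddCommGroup B] (f : A → B) :
    (q : ℕ) → (Fin (q + 1) → A) → B
  | 0, x => f (x 0)
  | q + 1, x =>
      discDeriv f q (Fin.cons (x 0 + x 1) fun i => x i.succ.succ)
        - discDeriv f q (Fin.cons (x 0) fun i => x i.succ.succ)
        - discDeriv f q (Fin.cons (x 1) fun i => x i.succ.succ)

open Finset

/-- The Möbius transform of a function on finite sets, for the order by inclusion. -/
def mobiusTransform {ι C : Type*} [AddCommGroup C] (φ : Finset ι → C) (J : Finset ι) : C :=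
  ∑ S ∈ J.powerset, (-1 : ℤ) ^ (#J + #S) • φ S

section mobiusTransform

variable {ι κ C : Type*} [AddCommGroup C]

@[simp] lemma mobiusTransform_empty (φ : Finset ι → C) : mobiusTransform φ ∅ = φ ∅ := by
  simp [mobiusTransform]

lemma mobiusTransform_sub (φ ψ : Finset ι → C) (J : Finset ι) :
    mobiusTransform (fun S => φ S - ψ S) J = mobiusTransform φ J - mobiusTransform ψ J := by
  simp [mobiusTransform, smul_sub]

lemma mobiusTransform_insert [DecidableEq ι] (φ : Finset ι → C) {a : ι} {J : Finset ι}
    (ha : a ∉ J) :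
    mobiusTransform φ (insert a J) = mobiusTransform (fun S => φ (insert a S) - φ S) J := by
  simp only [mobiusTransform, sum_powerset_insert ha, ← sum_add_distrib]
  refine sum_congr rfl fun S hS => ?_
  have haS : a ∉ S := fun h => ha (mem_powerset.mp hS h)
  rw [card_insert_of_notMem ha, card_insert_of_notMem haS, smul_sub]
  have h₁ : (-1 : ℤ) ^ (#J + 1 + #S) = -(-1) ^ (#J + #S) := by ring
  have h₂ : (-1 : ℤ) ^ (#J + 1 + (#S + 1)) = (-1) ^ (#J + #S) := by ring
  rw [h₁, h₂, neg_smul]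
  abel

lemma mobiusTransform_map (φ : Finset κ → C) (e : ι ↪ κ) (J : Finset ι) :
    mobiusTransform φ (J.map e) = mobiusTransform (fun S => φ (S.map e)) J := by
  classical
  induction J using Finset.induction generalizing φ with
  | empty => simp
  | insert a J ha ih =>
    rw [map_insert, mobiusTransform_insert _ (by simpa using ha), ih,
      mobiusTransform_insert _ ha]
    simp only [map_insert]

lemma mobiusTransform_univ_succ {n : ℕ} (φ : Finset (Fin (n + 1)) → C) :
    mobiusTransform φ univ = mobiusTransform
      (fun S => φ (insert 0 (S.map (Fin.succEmb n))) - φ (S.map (Fin.succEmb n))) univ := by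
  have h : (univ : Finset (Fin (n + 1))) = insert 0 (univ.map (Fin.succEmb n)) := by
    ext i
    cases i using Fin.cases <;> simp
  rw [h, mobiusTransform_insert _ (by simp [Fin.succ_ne_zero]), mobiusTransform_map]

/-- Möbius inversion. -/
lemma sum_powerset_mobiusTransform (φ : Finset ι → C) (K : Finset ι) :
    ∑ S ∈ K.powerset, mobiusTransform φ S = φ K := by
  classical
  induction K using Finset.induction generalizing φ with
  | empty => simp
  | insert a K ha ih =>
    have h : ∑ S ∈ K.powerset, mobiusTransform φ (insert a S) =
        ∑ S ∈ K.powerset, mobiusTransform (fun S => φ (insert a S) - φ S) S :=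
      sum_congr rfl fun S hS =>
        mobiusTransform_insert φ fun h => ha (mem_powerset.mp hS h)
    rw [sum_powerset_insert ha, h, ih, ih]
    abel

/-- A function on finite sets is determined by its sums over powersets. -/
lemma eq_of_sum_powerset_eq {u v : Finset ι → C}
    (h : ∀ K : Finset ι, ∑ S ∈ K.powerset, u S = ∑ S ∈ K.powerset, v S) (K : Finset ι) :
    u K = v K := by
  classical
  induction K using Finset.strongInduction with
  | H K ih =>
    have hK := h K
    rw [← sum_erase_add _ _ (mem_powerset_self K), ← sum_erase_add _ _ (mem_powerset_self K),
      sum_congr rfl fun S hS => ih S ?_] at hK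
    · exact add_left_cancel hK
    · rw [mem_erase, mem_powerset] at hS
      exact hS.2.ssubset_of_ne hS.1

end mobiusTransform

section discDerivOn

variable {A B C ι κ : Type*} [AddCommGroup A] [AddCommGroup B] [AddCommGroup C]

/-- The map sending a nonempty finite set `S` to `f (∑ i ∈ S, x i)`, and `∅` to `0`. -/
def mapSum (f : A → B) (x : ι → A) (S : Finset ι) : B :=
  open Classical in if S.Nonempty then f (∑ i ∈ S, x i) else 0

@[simp] lemma mapSum_empty (f : A → B) (x : ι → A) : mapSum f x ∅ = 0 := by
  simp [mapSum]

lemma mapSum_of_nonempty (f : A → B) (x : ι → A) {S : Finset ι} (hS : S.Nonempty) :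
    mapSum f x S = f (∑ i ∈ S, x i) :=
  if_pos hS

lemma mapSum_insert [DecidableEq ι] (f : A → B) (x : ι → A) {a : ι} {S : Finset ι}
    (ha : a ∉ S) : mapSum f x (insert a S) = f (x a + ∑ i ∈ S, x i) := by
  rw [mapSum_of_nonempty f x (insert_nonempty a S), sum_insert ha]

lemma mapSum_map (f : A → B) (x : κ → A) (e : ι ↪ κ) (S : Finset ι) :
    mapSum f x (S.map e) = mapSum f (x ∘ e) S := by
  simp [mapSum]

/-- The iterated discrete derivative of `f` along the family `(x j)` for `j ∈ J`, as an
alternating sum. -/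
def discDerivOn (f : A → B) (x : ι → A) (J : Finset ι) : B :=
  mobiusTransform (mapSum f x) J

@[simp] lemma discDerivOn_empty (f : A → B) (x : ι → A) : discDerivOn f x ∅ = 0 := by
  simp [discDerivOn]

lemma discDerivOn_map (f : A → B) (x : κ → A) (e : ι ↪ κ) (J : Finset ι) :
    discDerivOn f x (J.map e) = discDerivOn f (x ∘ e) J := by
  simp only [discDerivOn, mobiusTransform_map, mapSum_map]

lemma discDerivOn_univ_cons {n : ℕ} (f : A → B) (a : A) (y : Fin n → A) :
    discDerivOn f (Fin.cons a y : Fin (n + 1) → A) univ =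
      mobiusTransform (fun S => f (a + ∑ i ∈ S, y i) - mapSum f y S) univ := by
  rw [discDerivOn, mobiusTransform_univ_succ]
  congr 1
  funext S
  rw [mapSum_insert _ _ (by simp [Fin.succ_ne_zero]), mapSum_map, sum_map]
  rfl

lemma discDeriv_eq_discDerivOn_univ (f : A → B) (q : ℕ) (x : Fin (q + 1) → A) :
    discDeriv f q x = discDerivOn f x univ := by
  induction q with
  | zero =>
    rw [← Fin.cons_self_tail x, discDerivOn_univ_cons]
    simp [discDeriv]
  | succ q ih =>
    rw [discDeriv, ih, ih, ih, discDerivOn_univ_cons, discDerivOn_univ_cons,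
      discDerivOn_univ_cons, ← Fin.cons_self_tail x, discDerivOn_univ_cons,
      mobiusTransform_univ_succ, ← mobiusTransform_sub, ← mobiusTransform_sub]
    congr 1
    funext S
    have h0 : (0 : Fin (q + 1)) ∉ S.map (Fin.succEmb q) := by simp [Fin.succ_ne_zero]
    rw [mapSum_insert _ _ h0, mapSum_map, sum_insert h0, sum_map]
    simp only [Fin.cons_self_tail, Fin.tail, Fin.coe_succEmb, Function.comp_def,
      Fin.succ_zero_eq_one, add_assoc]
    abel

/-- Iterated discrete derivatives do not depend on the order of the arguments. -/
lemma discDeriv_eq_discDerivOn (f : A → B) (x : ι → A) {q : ℕ} {J : Finset ι}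
    (e : Fin (q + 1) ≃ {j // j ∈ J}) :
    discDeriv f q (fun i => x (e i)) = discDerivOn f x J := by
  have hJ : univ.map (e.toEmbedding.trans (Function.Embedding.subtype _)) = J := by
    rw [← map_map, map_univ_equiv, univ_eq_attach, attach_map_val]
  rw [discDeriv_eq_discDerivOn_univ]
  conv_rhs => rw [← hJ, discDerivOn_map]
  rfl

lemma sum_powerset_discDerivOn (f : A → B) (x : ι → A) (K : Finset ι) :
    ∑ S ∈ K.powerset, discDerivOn f x S = mapSum f x K :=
  sum_powerset_mobiusTransform _ _

/-- The discrete chain rule for finite subsets of an index type. -/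
lemma discDerivOn_comp [DecidableEq ι] (f : A → B) (g : B → C) (x : ι → A) (J : Finset ι) :
    discDerivOn (g ∘ f) x J =
      ∑ 𝒥 ∈ {𝒥 ∈ {T ∈ J.powerset | T.Nonempty}.powerset | 𝒥.sup id = J},
        discDerivOn g (discDerivOn f x) 𝒥 := by
  revert J
  refine eq_of_sum_powerset_eq fun K => ?_
  have hfiber : ∀ J ∈ K.powerset,
      {𝒥 ∈ {T ∈ J.powerset | T.Nonempty}.powerset | 𝒥.sup id = J} =
        {𝒥 ∈ {T ∈ K.powerset | T.Nonempty}.powerset | 𝒥.sup id = J} := by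
    intro J hJ
    ext 𝒥
    simp only [mem_filter, mem_powerset, subset_iff (s₁ := 𝒥), and_congr_left_iff] at hJ ⊢
    rintro rfl
    exact ⟨fun h T hT => ⟨(h hT).1.trans hJ, (h hT).2⟩,
      fun h T hT => ⟨le_sup (f := id) hT, (h hT).2⟩⟩
  rw [sum_powerset_discDerivOn, sum_congr rfl fun J hJ => by rw [hfiber J hJ],
    sum_fiberwise_of_maps_to, sum_powerset_discDerivOn]
  · rcases K.eq_empty_or_nonempty with rfl | hK
    · simp [filter_singleton]
    · have hne : {T ∈ K.powerset | T.Nonempty}.Nonempty := ⟨K, by simpa using hK⟩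
      have hsum : ∑ T ∈ K.powerset with T.Nonempty, discDerivOn f x T =
          ∑ T ∈ K.powerset, discDerivOn f x T :=
        sum_filter_of_ne fun T _ hT => nonempty_iff_ne_empty.mpr fun h => hT (by simp [h])
      rw [mapSum_of_nonempty _ _ hne, mapSum_of_nonempty _ _ hK, hsum,
        sum_powerset_discDerivOn, mapSum_of_nonempty _ _ hK, Function.comp_apply]
  · intro 𝒥 h𝒥
    rw [mem_powerset] at h𝒥 ⊢
    exact Finset.sup_le fun T hT => mem_powerset.mp (mem_filter.mp (h𝒥 hT)).1

end discDerivOn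

/-- **Discrete Chain Rule.** For arbitrary maps `f : A → B`, `g : B → C` between additive
commutative groups, a finite nonempty index set `J₁` and a family `x : J₁ → A`,
`(∂^{|J₁|−1}(g∘f))((x_j)_{j∈J₁})` equals the sum over all nonempty finite collections `𝒥`
of nonempty subsets of `J₁` whose union is `J₁` of
`(∂^{|𝒥|−1} g)` evaluated at the family `((∂^{|T|−1} f)((x_j)_{j∈T}))_{T∈𝒥}`,
all iterated discrete derivatives being evaluated in any order (the choices of
orders are the data `e₁`, `eT`, `e₂`). -/
theorem discrete_chain_rule {A B C : Type*}
    [AddCommGroup A] [AddCommGroup B] [AddCommGroup C]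
    (f : A → B) (g : B → C)
    (J₁ : Type*) [Fintype J₁] [DecidableEq J₁] [Nonempty J₁]
    (x : J₁ → A)
    (e₁ : Fin (Fintype.card J₁ - 1 + 1) ≃ J₁)
    (eT : ∀ T : Finset J₁, T.Nonempty → (Fin (T.card - 1 + 1) ≃ {j // j ∈ T}))
    (e₂ : ∀ 𝒥 : Finset (Finset J₁), 𝒥.Nonempty → (Fin (𝒥.card - 1 + 1) ≃ {T // T ∈ 𝒥})) :
    discDeriv (g ∘ f) (Fintype.card J₁ - 1) (fun i => x (e₁ i)) =
      ∑ 𝒥 : Finset (Finset J₁),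
        if h : 𝒥.Nonempty ∧ (∀ T ∈ 𝒥, T.Nonempty) ∧ 𝒥.sup id = Finset.univ then
          discDeriv g (𝒥.card - 1) (fun i =>
            discDeriv f ((↑(e₂ 𝒥 h.1 i) : Finset J₁).card - 1) (fun k =>
              x ↑(eT ↑(e₂ 𝒥 h.1 i) (h.2.1 _ (e₂ 𝒥 h.1 i).2) k)))
        else 0 := by
  have hleft : discDeriv (g ∘ f) (Fintype.card J₁ - 1) (fun i => x (e₁ i)) =
      discDerivOn (g ∘ f) x univ :=
    discDeriv_eq_discDerivOn _ x
      (e₁.trans (Equiv.subtypeUnivEquiv (fun j => Finset.mem_univ j)).symm)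
  rw [hleft, discDerivOn_comp, ← sum_subset (subset_univ _)]
  · refine sum_congr rfl fun 𝒥 h𝒥 => ?_
    simp only [mem_filter, mem_powerset, subset_iff (s₁ := 𝒥)] at h𝒥
    have hne : 𝒥.Nonempty := by
      rw [nonempty_iff_ne_empty]
      rintro rfl
      exact univ_nonempty.ne_empty h𝒥.2.symm
    rw [dif_pos ⟨hne, fun T hT => (h𝒥.1 hT).2, h𝒥.2⟩]
    simp only [discDeriv_eq_discDerivOn]
  · intro 𝒥 _ h𝒥
    refine dif_neg fun h => h𝒥 ?_
    simp only [mem_filter, mem_powerset, subset_iff (s₁ := 𝒥)]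
    exact ⟨fun T hT => ⟨fun _ _ => mem_univ _, h.2.1 T hT⟩, h.2.2⟩
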